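/- Let m ≥ 2 be an integer, a an integer with 0 ≤ a ≤ m−2, N a positive integer, M an integer coprime to N, and α = M/N. With Φ_m^{(a)}(τ) = Σ_{n∈ℤ} n χ_{2m}^{(a)}(n) e^{π i n² τ/(2m)} for Im τ > 0, the convergent integral √(m/(8i)) ∫_{α}^{i∞} Φ_m^{(a)}(τ) (τ − α)^{−1/2} dτ, taken along the vertical line {α + is : s ≥ 0} with the principal branch of the square root, equals m Σ_{n=0}^{mN} χ_{2m}^{(a)}(n) ( 1 − n/(mN) ) e^{π i M n²/(2mN)}. -/

import Mathlib

open scoped Real BigOperators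
open Complex (I)

/-- The odd periodic function `χ_{2m}^{(a)} : ℤ → ℂ` with period `2m`, taking the value
`+1` at `n ≡ m−1−a (mod 2m)`, `−1` at `n ≡ m+1+a (mod 2m)`, and `0` otherwise. -/
def chi (m a : ℕ) (n : ℤ) : ℂ :=
  if (n : ZMod (2 * m)) = ((m - 1 - a : ℕ) : ZMod (2 * m)) then 1
  else if (n : ZMod (2 * m)) = ((m + 1 + a : ℕ) : ZMod (2 * m)) then -1
  else 0

/-- The weight-`3/2` theta series
`Φ_m^{(a)}(τ) = Σ_{n∈ℤ} n χ_{2m}^{(a)}(n) e^{πin²τ/(2m)}` (for `Im τ > 0`). -/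
noncomputable def Phi (m a : ℕ) (τ : ℂ) : ℂ :=
  ∑' n : ℤ, (n : ℂ) * chi m a n * Complex.exp ((π : ℂ) * I * (n : ℂ) ^ 2 * τ / (2 * m))

section

open Set Filter Topology Asymptotics

/-- Generating function `∑_{n ≥ 1} wⁿ e^{-nt}`. -/
noncomputable def expGen (w : ℂ) (t : ℝ) : ℂ :=
  w * Complex.exp (-t) / (1 - w * Complex.exp (-t))

lemma norm_mul_exp_neg {w : ℂ} (hw : ‖w‖ = 1) (t : ℝ) :
    ‖w * Complex.exp (-t)‖ = Real.exp (-t) := by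
  rw [norm_mul, hw, one_mul, ← Complex.ofReal_neg, Complex.norm_exp_ofReal]

lemma one_sub_mul_exp_mem_slitPlane {w : ℂ} (hw : ‖w‖ = 1) (hw1 : w ≠ 1) {t : ℝ} (ht : 0 ≤ t) :
    1 - w * Complex.exp (-t) ∈ Complex.slitPlane := by
  have hre : w.re < 1 := by
    refine lt_of_le_of_ne (hw ▸ Complex.re_le_norm w) fun h ↦ hw1 ?_
    have h2 := Complex.sq_norm w
    rw [Complex.normSq_apply, hw, h] at h2
    exact Complex.ext h (by simpa using h2)
  left
  have h1 : Real.exp (-t) ≤ 1 := Real.exp_le_one_iff.mpr (by linarith)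
  have h0 := Real.exp_pos (-t)
  have : (w * Complex.exp (-t)).re = w.re * Real.exp (-t) := by
    rw [← Complex.ofReal_neg, ← Complex.ofReal_exp, Complex.re_mul_ofReal]
  rw [Complex.sub_re, this, Complex.one_re]
  nlinarith

lemma one_sub_mul_exp_ne_zero {w : ℂ} (hw : ‖w‖ = 1) (hw1 : w ≠ 1) {t : ℝ} (ht : 0 ≤ t) :
    1 - w * Complex.exp (-t) ≠ 0 :=
  Complex.slitPlane_ne_zero (one_sub_mul_exp_mem_slitPlane hw hw1 ht)

lemma continuousAt_expGen {w : ℂ} (hw : ‖w‖ = 1) (hw1 : w ≠ 1) {t : ℝ} (ht : 0 ≤ t) :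
    ContinuousAt (expGen w) t := by
  unfold expGen
  exact ContinuousAt.div (by fun_prop) (by fun_prop) (one_sub_mul_exp_ne_zero hw hw1 ht)

lemma tendsto_mul_exp_neg_atTop (w : ℂ) :
    Tendsto (fun t : ℝ ↦ w * Complex.exp (-t)) atTop (𝓝 0) := by
  have h : Tendsto (fun t : ℝ ↦ ((Real.exp (-t) : ℝ) : ℂ)) atTop (𝓝 ((0 : ℝ) : ℂ)) :=
    (Complex.continuous_ofReal.tendsto 0).comp (Real.tendsto_exp_neg_atTop_nhds_zero)
  simpa using h.const_mul w

lemma expGen_isBigO_atTop {w : ℂ} (hw : ‖w‖ = 1) :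
    expGen w =O[atTop] fun t ↦ Real.exp (-1 * t) := by
  have h1 : (fun t : ℝ ↦ w * Complex.exp (-t)) =O[atTop] fun t ↦ Real.exp (-1 * t) :=
    IsBigO.of_bound 1 (Eventually.of_forall fun t ↦ by
      rw [norm_mul_exp_neg hw, Real.norm_eq_abs, abs_of_pos (Real.exp_pos _)]; simp)
  have h2 : (fun t : ℝ ↦ (1 - w * Complex.exp (-t))⁻¹) =O[atTop] fun _ ↦ (1 : ℝ) := by
    refine Tendsto.isBigO_one ℝ (c := 1) ?_
    simpa using ((tendsto_mul_exp_neg_atTop w).const_sub 1).inv₀ (by simp)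
  refine (h1.mul h2).congr (fun t ↦ ?_) (fun t ↦ mul_one _)
  rw [expGen, div_eq_mul_inv]

lemma expGen_isBigO_zero {w : ℂ} (hw : ‖w‖ = 1) (hw1 : w ≠ 1) :
    expGen w =O[𝓝[>] 0] fun t : ℝ ↦ t ^ (-(0 : ℝ)) := by
  simpa using (((continuousAt_expGen hw hw1 le_rfl).tendsto).mono_left
    nhdsWithin_le_nhds).isBigO_one ℝ

lemma locallyIntegrableOn_expGen {w : ℂ} (hw : ‖w‖ = 1) (hw1 : w ≠ 1) :
    MeasureTheory.LocallyIntegrableOn (expGen w) (Ioi 0) :=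
  ContinuousOn.locallyIntegrableOn
    (fun _ ht ↦ (continuousAt_expGen hw hw1 (le_of_lt ht)).continuousWithinAt) measurableSet_Ioi

lemma mellin_expGen_one {w : ℂ} (hw : ‖w‖ = 1) (hw1 : w ≠ 1) :
    mellin (expGen w) 1 = -Complex.log (1 - w) := by
  have hint : MeasureTheory.IntegrableOn (expGen w) (Ioi 0) := by
    have h := mellinConvergent_of_isBigO_rpow_exp (s := 1) one_pos
      (locallyIntegrableOn_expGen hw hw1) (expGen_isBigO_atTop hw)
      (expGen_isBigO_zero hw hw1) (by simp)
    simpa [MellinConvergent] using h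
  have hderiv (t : ℝ) (ht : t ∈ Ici (0 : ℝ)) :
      HasDerivAt (fun t : ℝ ↦ Complex.log (1 - w * Complex.exp (-t))) (expGen w t) t := by
    have h1 : HasDerivAt (fun t : ℝ ↦ 1 - w * Complex.exp (-t)) (w * Complex.exp (-t)) t := by
      have := (((Complex.ofRealCLM.hasDerivAt (x := t)).neg.cexp).const_mul w).const_sub 1
      simpa using this
    exact h1.clog_real (one_sub_mul_exp_mem_slitPlane hw hw1 ht)
  have htend : Tendsto (fun t : ℝ ↦ Complex.log (1 - w * Complex.exp (-t))) atTop (𝓝 0) := by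
    have h := ((tendsto_mul_exp_neg_atTop w).const_sub 1).clog (by simp)
    simpa using h
  have := MeasureTheory.integral_Ioi_of_hasDerivAt_of_tendsto' hderiv hint htend
  simpa [mellin] using this

lemma hasSum_expGen {w : ℂ} (hw : ‖w‖ = 1) {t : ℝ} (ht : 0 < t) :
    HasSum (fun n : ℕ ↦ w ^ (n + 1) * Real.exp (-((n : ℝ) + 1) * t)) (expGen w t) := by
  have h := (hasSum_geometric_of_norm_lt_one (ξ := w * Complex.exp (-t))
    (by rw [norm_mul_exp_neg hw]; simpa using ht)).mul_left
      (w * Complex.exp (-t))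
  refine h.congr_fun fun n ↦ ?_
  rw [← pow_succ', mul_pow, ← Complex.exp_nat_mul]
  push_cast
  ring_nf

lemma mellin_expGen_eq_expZeta {a : ℝ} {s : ℂ} (hs : 1 < s.re) :
    mellin (expGen (Complex.exp (2 * π * I * a))) s = Complex.Gamma s * HurwitzZeta.expZeta a s := by
  set w := Complex.exp (2 * π * I * a) with hw_def
  have hw : ‖w‖ = 1 := by
    rw [hw_def, show (2 * π * I * a : ℂ) = (2 * π * a : ℝ) * I by push_cast; ring,
      Complex.norm_exp_ofReal_mul_I]
  have h1 := hasSum_mellin (s := s) (a := fun n : ℕ ↦ w ^ (n + 1)) (p := fun n ↦ (n : ℝ) + 1)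
    (F := expGen w) (fun n ↦ Or.inr (by positivity)) (by linarith)
    (fun t ht ↦ hasSum_expGen hw ht) (by
      simp only [norm_pow, hw, one_pow]
      exact_mod_cast (summable_nat_add_iff 1).mpr (Real.summable_one_div_nat_rpow.mpr hs))
  have h2 := (hasSum_nat_add_iff' 1).mpr (HurwitzZeta.hasSum_expZeta_of_one_lt_re a hs)
  have hs0 : s ≠ 0 := by rintro rfl; norm_num at hs
  simp only [Finset.range_one, Finset.sum_singleton, Nat.cast_zero, Complex.zero_cpow hs0,
    div_zero, sub_zero] at h2
  refine h1.unique ((h2.mul_left (Complex.Gamma s)).congr_fun fun n ↦ ?_)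
  rw [hw_def, ← Complex.exp_nat_mul]
  push_cast
  ring_nf

lemma coe_unitAddCircle_ne_zero {a : ℝ} (ha : a ∈ Ioo (0 : ℝ) 1) : (a : UnitAddCircle) ≠ 0 := by
  rw [Ne, AddCircle.coe_eq_zero_iff_of_mem_Ico (Ioo_subset_Ico_self ha)]
  exact ha.1.ne'

lemma expZeta_one {a : ℝ} (ha : (a : UnitAddCircle) ≠ 0) :
    HurwitzZeta.expZeta a 1 = -Complex.log (1 - Complex.exp (2 * π * I * a)) := by
  set w := Complex.exp (2 * π * I * a) with hw_def
  have hw : ‖w‖ = 1 := by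
    rw [hw_def, show (2 * π * I * a : ℂ) = (2 * π * a : ℝ) * I by push_cast; ring,
      Complex.norm_exp_ofReal_mul_I]
  have hw1 : w ≠ 1 := by
    intro h
    obtain ⟨n, hn⟩ := Complex.exp_eq_one_iff.mp h
    have : (a : ℂ) = n := by
      have := Complex.two_pi_I_ne_zero
      apply mul_left_cancel₀ this
      rw [hn]; ring
    refine ha (AddCircle.coe_eq_zero_iff (p := (1 : ℝ)) |>.mpr ⟨n, ?_⟩)
    simpa using (by exact_mod_cast this.symm : (n : ℝ) = a)
  rw [← mellin_expGen_one hw hw1]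
  have c1 : ContinuousAt (mellin (expGen w)) 1 :=
    (mellin_differentiableAt_of_isBigO_rpow_exp one_pos (locallyIntegrableOn_expGen hw hw1)
      (expGen_isBigO_atTop hw) (expGen_isBigO_zero hw hw1) (by simp)).continuousAt
  have c2 : ContinuousAt (fun s ↦ Complex.Gamma s * HurwitzZeta.expZeta a s) 1 :=
    (Complex.differentiableAt_Gamma_one.mul
      (HurwitzZeta.differentiable_expZeta_of_ne_zero ha 1)).continuousAt
  have hlim : Tendsto (fun x : ℝ ↦ (x : ℂ)) (𝓝[>] 1) (𝓝 1) :=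
    (Complex.continuous_ofReal.tendsto' 1 1 (by simp)).mono_left nhdsWithin_le_nhds
  have heq := tendsto_nhds_unique_of_eventuallyEq (c1.tendsto.comp hlim) (c2.tendsto.comp hlim)
    (by
      filter_upwards [self_mem_nhdsWithin] with x hx
      exact mellin_expGen_eq_expZeta (by simpa using hx))
  rw [heq, Complex.Gamma_one, one_mul]

lemma log_one_sub_exp {a : ℝ} (ha : a ∈ Ioo (0 : ℝ) 1) :
    Complex.log (1 - Complex.exp (2 * π * I * a)) =
      Real.log (2 * Real.sin (π * a)) + (π * (a - 1 / 2) : ℝ) * I := by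
  have hsin : 0 < Real.sin (π * a) :=
    Real.sin_pos_of_pos_of_lt_pi (mul_pos Real.pi_pos ha.1) (by nlinarith [Real.pi_pos, ha.2])
  have key : 1 - Complex.exp (2 * π * I * a) =
      (2 * Real.sin (π * a) : ℝ) * Complex.exp ((π * (a - 1 / 2) : ℝ) * I) := by
    have e1 : Complex.exp ((π * (a - 1 / 2) : ℝ) * I) = Complex.exp (π * a * I) * (-I) := by
      rw [← Complex.exp_neg_pi_div_two_mul_I, ← Complex.exp_add]; push_cast; ring_nf
    have e2 : Complex.exp (2 * π * I * a) = Complex.exp (π * a * I) * Complex.exp (π * a * I) := by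
      rw [← Complex.exp_add]; ring_nf
    have e3 : Complex.exp (-(π * a) * I) * Complex.exp (π * a * I) = 1 := by
      rw [← Complex.exp_add]; simp
    rw [e1, e2]
    push_cast
    rw [Complex.sin]
    linear_combination (I ^ 2) * e3 +
      (1 - Complex.exp (π * a * I) * Complex.exp (π * a * I)) * Complex.I_sq
  rw [key, Complex.log_ofReal_mul (by positivity) (Complex.exp_ne_zero _), Complex.log_exp] <;>
  · simp only [Complex.im_ofReal_mul, Complex.I_im]
    nlinarith [Real.pi_pos, ha.1, ha.2]

lemma sinZeta_one {a : ℝ} (ha : a ∈ Ioo (0 : ℝ) 1) :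
    HurwitzZeta.sinZeta a 1 = π * (1 / 2 - a) := by
  have ha' := coe_unitAddCircle_ne_zero ha
  have hb : 1 - a ∈ Ioo (0 : ℝ) 1 := ⟨by linarith [ha.2], by linarith [ha.1]⟩
  have hb' := coe_unitAddCircle_ne_zero hb
  have hneg : (-(a : UnitAddCircle)) = ((1 - a : ℝ) : UnitAddCircle) := by
    rw [sub_eq_add_neg, AddCircle.coe_add, AddCircle.coe_period, zero_add, AddCircle.coe_neg]
  rw [HurwitzZeta.sinZeta_eq, hneg, expZeta_one ha', expZeta_one hb', log_one_sub_exp ha,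
    log_one_sub_exp hb, show π * (1 - a) = π - π * a by ring, Real.sin_pi_sub]
  field_simp
  push_cast
  ring

lemma hurwitzZetaOdd_zero {a : ℝ} (ha : a ∈ Ioo (0 : ℝ) 1) :
    HurwitzZeta.hurwitzZetaOdd a 0 = 1 / 2 - a := by
  have h := HurwitzZeta.hurwitzZetaOdd_one_sub a (s := 1) (fun n hn ↦ by
    have := congrArg Complex.re hn
    simp at this
    linarith [n.cast_nonneg (α := ℝ)])
  rw [sub_self, sinZeta_one ha, Complex.Gamma_one, mul_one (π : ℂ), Complex.sin_pi_div_two,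
    Complex.cpow_neg_one] at h
  rw [h]
  have : (π : ℂ) ≠ 0 := by exact_mod_cast Real.pi_ne_zero
  field_simp

/-- The theta series `∑_{n ∈ ℤ} n f(n) e^{-π n² t}`. -/
noncomputable def oddTheta (f : ℤ → ℂ) (t : ℝ) : ℂ :=
  ∑' n : ℤ, (n : ℂ) * f n * Complex.exp (-π * (n : ℂ) ^ 2 * t)

lemma oddTheta_eq_sum_oddKernel {f : ℤ → ℂ} {L : ℕ} (hL : 0 < L)
    (hf : ∀ n, f (n + L) = f n) {t : ℝ} (ht : 0 < t) :
    oddTheta f t = ∑ r ∈ Finset.range L,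
      f r * L * (HurwitzZeta.oddKernel ((r / L : ℝ) : UnitAddCircle) (L ^ 2 * t) : ℂ) := by
  have : NeZero L := ⟨hL.ne'⟩
  have hL' : (L : ℂ) ≠ 0 := by exact_mod_cast hL.ne'
  have hper (r k : ℤ) : f (k * L + r) = f r := by
    rw [add_comm]
    exact (show Function.Periodic f (L : ℤ) from hf).int_mul k r
  have h1 (r : Fin L) : HasSum (fun k : ℤ ↦ (((k * L + r : ℤ) : ℂ) * f (k * L + r) *
      Complex.exp (-π * ((k * L + r : ℤ) : ℂ) ^ 2 * t)))
      (f r * L * (HurwitzZeta.oddKernel ((r / L : ℝ) : UnitAddCircle) (L ^ 2 * t) : ℂ)) := by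
    have h := (Complex.hasSum_ofReal.mpr (HurwitzZeta.hasSum_int_oddKernel (r / L : ℝ)
      (x := L ^ 2 * t) (by positivity))).mul_left (f r * L)
    refine h.congr_fun fun k ↦ ?_
    rw [hper]
    have e : (-π * ((k * L + r : ℤ) : ℂ) ^ 2 * t) =
      ((-π * (k + r / L : ℝ) ^ 2 * (L ^ 2 * t) : ℝ) : ℂ) := by
      push_cast
      field_simp
    rw [e]
    push_cast
    field_simp
  have h2 : HasSum (fun n : ℤ ↦ (n : ℂ) * f n * Complex.exp (-π * (n : ℂ) ^ 2 * t))
      (∑ r : Fin L,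
        f r * L * (HurwitzZeta.oddKernel ((r / L : ℝ) : UnitAddCircle) (L ^ 2 * t) : ℂ)) := by
    rw [← (Int.divModEquiv L).symm.hasSum_iff]
    have h3 (r : Fin L) := (Function.Injective.hasSum_iff (Prod.mk_left_injective r)
      (f := fun p : ℤ × Fin L ↦ if p.2 = r then (((p.1 * L + r : ℤ) : ℂ) * f (p.1 * L + r) *
        Complex.exp (-π * ((p.1 * L + r : ℤ) : ℂ) ^ 2 * t)) else 0)
      (fun p hp ↦ if_neg fun h ↦ hp ⟨p.1, by rw [← h]⟩)).mp (by
        simpa only [Function.comp_def, if_true] using h1 r)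
    refine (hasSum_sum fun r _ ↦ h3 r).congr_fun fun p ↦ ?_
    simp
  rw [oddTheta, h2.tsum_eq, Fin.sum_univ_eq_sum_range (fun r : ℕ ↦
    f r * L * (HurwitzZeta.oddKernel ((r / L : ℝ) : UnitAddCircle) (L ^ 2 * t) : ℂ))]

lemma hasMellin_oddKernel {a : ℝ} (ha : a ∈ Ioo (0 : ℝ) 1) :
    HasMellin (fun t ↦ (HurwitzZeta.oddKernel a t : ℂ)) (1 / 2) (1 - 2 * a) := by
  have h := (HurwitzZeta.isStrong_hurwitzOddFEPair (a : UnitAddCircle)).hasMellin (1 / 2)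
  have hΛ : (HurwitzZeta.hurwitzOddFEPair (a : UnitAddCircle)).Λ (1 / 2) = 1 - 2 * a := by
    have h0 := hurwitzZetaOdd_zero ha
    rw [HurwitzZeta.hurwitzZetaOdd, HurwitzZeta.completedHurwitzZetaOdd, zero_add,
      Complex.Gammaℝ_one, div_one] at h0
    linear_combination 2 * h0
  rw [hΛ] at h
  exact h

lemma hasMellin_oddKernel_mul {a c : ℝ} (ha : a ∈ Ioo (0 : ℝ) 1) (hc : 0 < c) :
    HasMellin (fun t ↦ (HurwitzZeta.oddKernel a (c ^ 2 * t) : ℂ)) (1 / 2) ((1 - 2 * a) / c) := by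
  have h := hasMellin_oddKernel ha
  refine ⟨(MellinConvergent.comp_mul_left (by positivity)).mpr h.1, ?_⟩
  rw [mellin_comp_mul_left (fun t ↦ (HurwitzZeta.oddKernel a t : ℂ)) _ (by positivity), h.2,
    smul_eq_mul, Complex.cpow_neg, show ((1 / 2 : ℂ)) = ((1 / 2 : ℝ) : ℂ) by push_cast; rfl,
    ← Complex.ofReal_cpow (by positivity), ← Real.sqrt_eq_rpow, Real.sqrt_sq hc.le]
  ring

lemma mellin_oddTheta {f : ℤ → ℂ} {L : ℕ} (hL : 0 < L) (hf : ∀ n, f (n + L) = f n)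
    (hf0 : f 0 = 0) :
    mellin (oddTheta f) (1 / 2) = ∑ r ∈ Finset.range L, f r * (1 - 2 * (r / L)) := by
  have hL' : (0 : ℝ) < L := by exact_mod_cast hL
  have key (r : ℕ) (hr : r ∈ Finset.range L) : HasMellin (fun t ↦
      f r * L * (HurwitzZeta.oddKernel ((r / L : ℝ) : UnitAddCircle) (L ^ 2 * t) : ℂ)) (1 / 2)
      (f r * (1 - 2 * (r / L))) := by
    rcases Nat.eq_zero_or_pos r with rfl | hr0
    · simp [hf0, HasMellin, MellinConvergent, mellin]
    · have hrL : (r / L : ℝ) ∈ Ioo (0 : ℝ) 1 :=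
        ⟨by positivity, (div_lt_one hL').mpr (by exact_mod_cast Finset.mem_range.mp hr)⟩
      have h := hasMellin_oddKernel_mul hrL hL'
      refine ⟨h.1.const_smul (f r * L), ?_⟩
      have h2 := mellin_const_smul (fun t ↦ (HurwitzZeta.oddKernel ((r / L : ℝ) : UnitAddCircle)
        ((L : ℝ) ^ 2 * t) : ℂ)) (1 / 2) (f r * L)
      rw [h.2] at h2
      simp only [smul_eq_mul] at h2
      rw [h2]
      have : (L : ℂ) ≠ 0 := by exact_mod_cast hL.ne'
      push_cast
      field_simp
  rw [← Finset.sum_congr rfl fun r hr ↦ (key r hr).2]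
  simp only [mellin]
  rw [← MeasureTheory.integral_finsetSum _ fun r hr ↦ (key r hr).1]
  refine MeasureTheory.setIntegral_congr_fun measurableSet_Ioi fun t ht ↦ ?_
  simp only [smul_eq_mul]
  rw [oddTheta_eq_sum_oddKernel hL hf ht, Finset.mul_sum]

lemma chi_add (m a : ℕ) (n k : ℤ) : chi m a (n + 2 * m * k) = chi m a n := by
  have : ((n + 2 * m * k : ℤ) : ZMod (2 * m)) = n := by
    have h : ((2 * m : ℕ) : ZMod (2 * m)) = 0 := ZMod.natCast_self _
    push_cast at h ⊢
    rw [h]; ring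
  simp only [chi, this]

lemma chi_neg {m a : ℕ} (hm : 2 ≤ m) (ha : a ≤ m - 2) (n : ℤ) : chi m a (-n) = -chi m a n := by
  have h : ((m - 1 - a : ℕ) : ZMod (2 * m)) = -((m + 1 + a : ℕ) : ZMod (2 * m)) := by
    rw [eq_neg_iff_add_eq_zero, ← Nat.cast_add, show m - 1 - a + (m + 1 + a) = 2 * m by omega]
    exact ZMod.natCast_self _
  have hne : ((m - 1 - a : ℕ) : ZMod (2 * m)) ≠ ((m + 1 + a : ℕ) : ZMod (2 * m)) := by
    rw [Ne, ZMod.natCast_eq_natCast_iff', Nat.mod_eq_of_lt (by omega), Nat.mod_eq_of_lt (by omega)]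
    omega
  rw [h] at hne
  simp only [chi, Int.cast_neg, h, neg_eq_iff_eq_neg (a := (n : ZMod (2 * m)))]
  split_ifs <;> simp_all

/-- The odd function `n ↦ χ(n) e^{πiMn²/(2mN)}`, of period `2mN`. -/
noncomputable def chiGauss (m a N : ℕ) (M n : ℤ) : ℂ :=
  chi m a n * Complex.exp ((π : ℂ) * I * M * (n : ℂ) ^ 2 / (2 * m * N))

lemma chiGauss_neg {m a : ℕ} (hm : 2 ≤ m) (ha : a ≤ m - 2) (N : ℕ) (M n : ℤ) :
    chiGauss m a N M (-n) = -chiGauss m a N M n := by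
  simp [chiGauss, chi_neg hm ha]

lemma chiGauss_periodic {m N : ℕ} (hm : m ≠ 0) (hN : N ≠ 0) (a : ℕ) (M n : ℤ) :
    chiGauss m a N M (n + (2 * (m * N) : ℕ)) = chiGauss m a N M n := by
  have hm' : (m : ℂ) ≠ 0 := by exact_mod_cast hm
  have hN' : (N : ℂ) ≠ 0 := by exact_mod_cast hN
  have e : (π : ℂ) * I * M * ((n + (2 * (m * N) : ℕ) : ℤ) : ℂ) ^ 2 / (2 * m * N) =
      (π : ℂ) * I * M * (n : ℂ) ^ 2 / (2 * m * N) +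
        ((M * (n + m * N) : ℤ) : ℂ) * (2 * π * I) := by
    push_cast
    field_simp
    ring
  rw [chiGauss, chiGauss, e, Complex.exp_add, Complex.exp_int_mul_two_pi_mul_I, mul_one,
    show n + ((2 * (m * N) : ℕ) : ℤ) = n + 2 * m * N by push_cast; ring, chi_add]

lemma sum_range_two_mul_of_odd_periodic {f : ℤ → ℂ} {K : ℕ} (hK : 0 < K)
    (hf : ∀ n, f (n + (2 * K : ℕ)) = f n) (hodd : ∀ n, f (-n) = -f n) :
    ∑ r ∈ Finset.range (2 * K), f r * (1 - 2 * (r / (2 * K : ℕ))) =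
      2 * ∑ r ∈ Finset.range (K + 1), f r * (1 - r / K) := by
  have hK' : (K : ℂ) ≠ 0 := by exact_mod_cast hK.ne'
  have hf0 : f 0 = 0 := by simpa [self_eq_neg] using hodd 0
  set g : ℕ → ℂ := fun r ↦ f r * (1 - r / K) with hg
  have hg0 : g 0 = 0 := by simp [hg, hf0]
  have hgK : g K = 0 := by simp [hg, hK']
  have hrefl (r : ℕ) (hr : r ≤ K) : g (K + (K - r)) = g r := by
    have : f ((K + (K - r) : ℕ) : ℤ) = -f r := by
      rw [← hodd, ← hf (-r)]
      congr 1
      omega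
    simp only [hg, this]
    push_cast [hr]
    field_simp
    ring
  have h1 : ∑ r ∈ Finset.range (2 * K), f r * (1 - 2 * (r / (2 * K : ℕ))) =
      ∑ r ∈ Finset.range (2 * K), g r := by
    refine Finset.sum_congr rfl fun r _ ↦ ?_
    simp only [hg]
    push_cast
    field_simp
  have h2 : ∑ i ∈ Finset.range K, g (K + i) = ∑ r ∈ Finset.range (K + 1), g r := by
    have h3 : g (K + K) = 0 := by simpa [hg0] using hrefl 0 (Nat.zero_le K)
    rw [← add_zero (∑ i ∈ Finset.range K, g (K + i)), ← h3, ← Finset.sum_range_succ,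
      ← Finset.sum_range_reflect]
    refine Finset.sum_congr rfl fun r hr ↦ ?_
    rw [Nat.add_sub_cancel, hrefl r (Nat.lt_succ_iff.mp (Finset.mem_range.mp hr))]
  rw [h1, two_mul K, Finset.sum_range_add, h2, Finset.sum_range_succ, hgK]
  ring

lemma Phi_eq_oddTheta {m N : ℕ} (hm : m ≠ 0) (hN : N ≠ 0) (a : ℕ) (M : ℤ) (s : ℝ) :
    Phi m a (((M : ℝ) / N : ℝ) + (s : ℂ) * I) =
      oddTheta (chiGauss m a N M) ((2 * m : ℝ)⁻¹ * s) := by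
  have hm' : (m : ℂ) ≠ 0 := by exact_mod_cast hm
  have hN' : (N : ℂ) ≠ 0 := by exact_mod_cast hN
  refine tsum_congr fun n ↦ ?_
  rw [chiGauss, ← mul_assoc, mul_assoc _ (Complex.exp _), ← Complex.exp_add]
  congr 2
  push_cast
  field_simp
  linear_combination (n : ℂ) ^ 2 * s * N * Complex.I_sq

lemma ofReal_mul_I_cpow {s : ℝ} (hs : 0 < s) :
    ((s : ℂ) * I) ^ (-((1 : ℂ) / 2)) = (s : ℂ) ^ ((1 / 2 : ℂ) - 1) * Complex.exp (-(π / 4) * I) := by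
  have hs' : (s : ℂ) ≠ 0 := by exact_mod_cast hs.ne'
  rw [Complex.cpow_def_of_ne_zero (mul_ne_zero hs' Complex.I_ne_zero),
    Complex.cpow_def_of_ne_zero hs', Complex.log_ofReal_mul hs Complex.I_ne_zero, Complex.log_I,
    ← Complex.ofReal_log hs.le, ← Complex.exp_add]
  ring_nf

lemma cpow_prefactor {m : ℕ} (hm : 0 < m) :
    ((m : ℂ) / (8 * I)) ^ ((1 : ℂ) / 2) * (((2 * m : ℝ)⁻¹ : ℝ) : ℂ) ^ (-(1 / 2 : ℂ)) =
      m / 2 * Complex.exp (-(π / 4) * I) := by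
  have hm' : (0 : ℝ) < m := by exact_mod_cast hm
  have e : (m : ℂ) / (8 * I) = ((m / 8 : ℝ) : ℂ) * (-I) := by
    push_cast
    rw [← div_div, div_eq_mul_inv _ I, Complex.inv_I]
  have h0 : ((m / 8 : ℝ) : ℂ) ≠ 0 := by exact_mod_cast (by positivity : (m / 8 : ℝ) ≠ 0)
  have h1 : ((m : ℂ) / (8 * I)) ^ ((1 : ℂ) / 2) =
      ((√(m / 8) : ℝ) : ℂ) * Complex.exp (-(π / 4) * I) := by
    rw [e, Real.sqrt_eq_rpow, Complex.ofReal_cpow (by positivity),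
      Complex.cpow_def_of_ne_zero (mul_ne_zero h0 (neg_ne_zero.mpr Complex.I_ne_zero)),
      Complex.cpow_def_of_ne_zero h0, Complex.log_ofReal_mul (by positivity)
      (neg_ne_zero.mpr Complex.I_ne_zero), Complex.log_neg_I, Complex.ofReal_log (by positivity),
      ← Complex.exp_add]
    push_cast
    ring_nf
  have h2 : (((2 * m : ℝ)⁻¹ : ℝ) : ℂ) ^ (-(1 / 2 : ℂ)) = ((√(2 * m) : ℝ) : ℂ) := by
    rw [show (-(1 / 2 : ℂ)) = ((-(1 / 2) : ℝ) : ℂ) by push_cast; rfl,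
      ← Complex.ofReal_cpow (by positivity), Real.inv_rpow (by positivity),
      Real.rpow_neg (by positivity), inv_inv, ← Real.sqrt_eq_rpow]
  have h3 : √(m / 8 : ℝ) * √(2 * m) = m / 2 := by
    rw [← Real.sqrt_mul (by positivity), show (m / 8 * (2 * m) : ℝ) = (m / 2) ^ 2 by ring,
      Real.sqrt_sq (by positivity)]
  rw [h1, h2, mul_right_comm, ← Complex.ofReal_mul, h3]
  push_cast
  rfl

end

/-- for `m ≥ 2`, `0 ≤ a ≤ m−2`, `N ≥ 1`, `M` coprime to `N` and
`α = M/N`, the convergent integral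
`√(m/(8i)) ∫_α^{i∞} Φ_m^{(a)}(τ) (τ−α)^{−1/2} dτ`, taken along the vertical line
`{α + is : s ≥ 0}` (so `τ − α = is`, `dτ = i ds`, principal branches), equals
`m Σ_{n=0}^{mN} χ_{2m}^{(a)}(n) (1 − n/(mN)) e^{πiMn²/(2mN)}`. -/
theorem stmt17 (m a : ℕ) (hm : 2 ≤ m) (ha : a ≤ m - 2) (N : ℕ) (hN : 0 < N)
    (M : ℤ) (hMN : IsCoprime M (N : ℤ)) :
    ((m : ℂ) / (8 * I)) ^ ((1 : ℂ) / 2) *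
        (∫ s in Set.Ioi (0 : ℝ),
          Phi m a (((M : ℝ) / N : ℝ) + (s : ℂ) * I) *
            (((s : ℂ) * I) ^ (-((1 : ℂ) / 2))) * I) =
      (m : ℂ) * ∑ n ∈ Finset.range (m * N + 1),
        chi m a n * (1 - (n : ℂ) / (m * N)) *
          Complex.exp ((π : ℂ) * I * M * (n : ℂ) ^ 2 / (2 * m * N)) := by
  have hm0 : m ≠ 0 := by omega
  have hN0 : N ≠ 0 := hN.ne'
  have hint : (∫ s in Set.Ioi (0 : ℝ), Phi m a (((M : ℝ) / N : ℝ) + (s : ℂ) * I) *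
      (((s : ℂ) * I) ^ (-((1 : ℂ) / 2))) * I) = (((2 * m : ℝ)⁻¹ : ℝ) : ℂ) ^ (-(1 / 2 : ℂ)) *
        mellin (oddTheta (chiGauss m a N M)) (1 / 2) * (Complex.exp (-(π / 4) * I) * I) := by
    rw [← smul_eq_mul (((2 * m : ℝ)⁻¹ : ℝ) ^ (-(1 / 2 : ℂ)) : ℂ),
      ← mellin_comp_mul_left _ _ (by positivity), mellin, ← MeasureTheory.integral_mul_const]
    refine MeasureTheory.setIntegral_congr_fun measurableSet_Ioi fun s hs ↦ ?_
    simp only [smul_eq_mul]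
    rw [Phi_eq_oddTheta hm0 hN0, ofReal_mul_I_cpow hs]
    ring
  have hodd := chiGauss_neg hm ha N M
  have hexp : Complex.exp (-(π / 4) * I) * (Complex.exp (-(π / 4) * I) * I) = 1 := by
    rw [← mul_assoc, ← Complex.exp_add, show -(π / 4 : ℂ) * I + -(π / 4) * I = -π / 2 * I by ring,
      Complex.exp_neg_pi_div_two_mul_I, neg_mul, Complex.I_mul_I, neg_neg]
  rw [hint, ← mul_assoc, ← mul_assoc (((m : ℂ) / (8 * I)) ^ _), cpow_prefactor (by omega),
    mellin_oddTheta (by positivity) (chiGauss_periodic hm0 hN0 a M)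
      (by simpa [self_eq_neg] using hodd 0),
    sum_range_two_mul_of_odd_periodic (by positivity) (chiGauss_periodic hm0 hN0 a M) hodd]
  have hsum : ∑ n ∈ Finset.range (m * N + 1), chi m a n * (1 - (n : ℂ) / (m * N)) *
      Complex.exp ((π : ℂ) * I * M * (n : ℂ) ^ 2 / (2 * m * N)) =
      ∑ n ∈ Finset.range (m * N + 1), chiGauss m a N M n * (1 - n / (m * N : ℕ)) := by
    refine Finset.sum_congr rfl fun n _ ↦ ?_
    rw [chiGauss]
    push_cast
    ring
  rw [hsum]
  linear_combination (m : ℂ) * (∑ n ∈ Finset.range (m * N + 1),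
    chiGauss m a N M n * (1 - n / (m * N : ℕ))) * hexp
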